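/- arXiv:1602.05337 — 2 statements merged into one kernel-verified Lean document; each statement's English description precedes it below -/
import Mathlib

section
/- For n ≥ 3, the vector v = (1, λ, λ², ..., λ^{n-2}, λ^{n-1}, λ^{n-2}, ..., λ, 1) is a right eigenvector of the adjacency matrix S_n with eigenvalue λ, where λ is any root of λ^n = 2(1 + λ + ... + λ^{n-2}). -/
/-- The `(2n-1)×(2n-1)` adjacency matrix `S_n`. -/
def adjMat (n : ℕ) : Matrix (Fin (2 * n - 1)) (Fin (2 * n - 1)) ℝ := fun r c =>
  if r.val < n - 1 then (if c.val = r.val + 1 then 1 else 0)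
  else if r.val = n - 1 then (if c.val = n - 1 then 0 else 1)
  else (if c.val = r.val - 1 then 1 else 0)

/-- Removing the middle term from the palindromic sum `1 + l + ⋯ + l ^ m + ⋯ + l + 1` leaves
twice the sum of the first `m` powers of `l`. -/
theorem sum_range_pow_min_ne_middle (m : ℕ) (l : ℝ) :
    ∑ c ∈ Finset.range (2 * m + 1), (if c = m then 0 else l ^ min c (2 * m - c)) =
      2 * ∑ i ∈ Finset.range m, l ^ i := by
  rw [show 2 * m + 1 = (m + 1) + m by omega, Finset.sum_range_add, Finset.sum_range_succ,
    ← Finset.sum_range_reflect (fun x => if m + 1 + x = m then (0 : ℝ) else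
      l ^ min (m + 1 + x) (2 * m - (m + 1 + x))), two_mul (Finset.sum _ _)]
  simp only [if_true, add_zero]
  congr 1 <;> refine Finset.sum_congr rfl fun i hi => ?_ <;> rw [Finset.mem_range] at hi <;>
    rw [if_neg (by omega)] <;> congr 1 <;> omega

/-- For `n ≥ 3`, the vector `v = (1, λ, λ², …, λ^{n-1}, λ^{n-2}, …, λ, 1)` is a right
eigenvector of `S_n` with eigenvalue `λ`, for any root `λ` of
`λ^n = 2(1 + λ + ⋯ + λ^{n-2})`. -/
theorem stmt14 (n : ℕ) (hn : 3 ≤ n) (l : ℝ)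
    (hl : l ^ n = 2 * ∑ i ∈ Finset.range (n - 1), l ^ i)
    (v : Fin (2 * n - 1) → ℝ)
    (hv : ∀ k, v k = l ^ (min k.val (2 * n - 2 - k.val))) :
    (adjMat n).mulVec v = l • v := by
  ext r
  have hr := r.isLt
  simp only [Matrix.mulVec, dotProduct, adjMat, Pi.smul_apply, smul_eq_mul, hv]
  rw [← pow_succ']
  rcases lt_trichotomy r.val (n - 1) with h | h | h
  · simp only [if_pos h]
    rw [Finset.sum_eq_single (⟨r.val + 1, by omega⟩ : Fin (2 * n - 1))]
    · rw [if_pos rfl, one_mul]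
      congr 1
      dsimp only
      omega
    · intro c _ hc
      rw [if_neg (fun h' => hc (Fin.ext h')), zero_mul]
    · simp
  · simp only [h, lt_irrefl, if_false, if_true, ite_mul, zero_mul, one_mul]
    rw [Fin.sum_univ_eq_sum_range
      (fun c => if c = n - 1 then (0 : ℝ) else l ^ min c (2 * n - 2 - c)) (2 * n - 1),
      show 2 * n - 1 = 2 * (n - 1) + 1 by omega, show 2 * n - 2 = 2 * (n - 1) by omega,
      sum_range_pow_min_ne_middle, ← hl]
    congr 1
    omega
  · simp only [if_neg h.not_gt, if_neg h.ne']
    rw [Finset.sum_eq_single (⟨r.val - 1, by omega⟩ : Fin (2 * n - 1))]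
    · rw [if_pos rfl, one_mul]
      congr 1
      dsimp only
      omega
    · intro c _ hc
      rw [if_neg (fun h' => hc (Fin.ext h')), zero_mul]
    · simp
end

section
/- Let n ≥ 3 and λ ∈ (1,2) satisfy λ^n = 2(1 + λ + ... + λ^{n-2}). Then [2/(λ−1)·(λ^{n-1} − n + λ^n/2) + λ^n]·(log λ)/λ^n < log(2n−2). That is, the entropy of the induced measure coming from the Parry measure of K is strictly less than the maximal entropy log(2n−2) of the induced system. -/
/-- If `C ≤ a / b` and `l ^ a < x ^ b`, then `C * log l < log x`. -/
lemma mul_log_lt_log_of_pow_lt_pow {C l x : ℝ} {a b : ℕ} (hb : 0 < b) (hl : 1 < l)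
    (hC : b * C ≤ a) (hpow : l ^ a < x ^ b) : C * Real.log l < Real.log x := by
  have h := Real.log_lt_log (by positivity) hpow
  rw [Real.log_pow, Real.log_pow] at h
  have hb' : (0 : ℝ) < b := by exact_mod_cast hb
  have h2 := mul_le_mul_of_nonneg_right hC (Real.log_pos hl).le
  refine lt_of_mul_lt_mul_left ?_ hb'.le
  linarith

/-- The defining equation of `l`, with the geometric sum evaluated. -/
lemma pow_mul_two_sub_mul_add_one {m : ℕ} {l : ℝ}
    (hl : l ^ (m + 1) = 2 * ∑ i ∈ Finset.range m, l ^ i) :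
    l ^ m * ((2 - l) * (l + 1)) = 2 := by
  have h := geom_sum_mul l m
  have h2 : l ^ (m + 1) * (l - 1) = 2 * (l ^ m - 1) := by rw [hl, mul_assoc, h]
  rw [pow_succ] at h2
  linarith

/-- The factor in front of `log l`, with the power of `l` eliminated. -/
lemma entropy_factor_eq {m : ℕ} {l : ℝ} (hl1 : 1 < l)
    (h : l ^ m * ((2 - l) * (l + 1)) = 2) :
    (2 / (l - 1) * (l ^ m - ((m + 1 : ℕ) : ℝ) + l ^ (m + 1) / 2) + l ^ (m + 1)) / l ^ (m + 1)
      = 3 - (2 - l) * (m * (l + 1) - l) / (l * (l - 1)) := by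
  have h0 : l ≠ 0 := by positivity
  have h1 : l - 1 ≠ 0 := by linarith
  have hp : l ^ m ≠ 0 := by positivity
  rw [pow_succ]
  push_cast
  generalize l ^ m = p at *
  field_simp
  linear_combination ((m : ℝ) + 1) * h

theorem stmt17 (n : ℕ) (hn : 3 ≤ n) (l : ℝ) (hl1 : 1 < l) (hl2 : l < 2)
    (hl : l ^ n = 2 * ∑ i ∈ Finset.range (n - 1), l ^ i) :
    (2 / (l - 1) * (l ^ (n - 1) - n + l ^ n / 2) + l ^ n) * Real.log l / l ^ n
      < Real.log (2 * n - 2) := by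
  obtain ⟨m, rfl⟩ : ∃ m, n = m + 1 := ⟨n - 1, by omega⟩
  rw [Nat.add_sub_cancel] at *
  have h := pow_mul_two_sub_mul_add_one hl
  rw [mul_div_right_comm, entropy_factor_eq hl1 h]
  have hd : 0 < l * (l - 1) := mul_pos (by linarith) (by linarith)
  obtain rfl | rfl | hm : m = 2 ∨ m = 3 ∨ 4 ≤ m := by omega
  · have hu : l < 1.77 := by
      by_contra! hc
      nlinarith [mul_nonneg (sub_nonneg.2 hc) (sq_nonneg l)]
    refine mul_log_lt_log_of_pow_lt_pow (a := 12) (b := 5) (by norm_num) hl1 ?_ ?_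
    · have : 3 / 5 ≤ (2 - l) * ((2 : ℕ) * (l + 1) - l) / (l * (l - 1)) := by
        rw [le_div_iff₀ hd]
        push_cast
        nlinarith
      push_cast at *
      linarith
    · calc l ^ 12 < 1.77 ^ 12 := by gcongr
        _ < _ := by norm_num
  · have hu : l < 1.9 := by
      by_contra! hc
      have h3 : (1.9 : ℝ) ^ 2 ≤ l ^ 2 := by gcongr
      simp only [Finset.sum_range_succ, Finset.sum_range_zero] at hl
      nlinarith [mul_nonneg (sub_nonneg.2 hc) (sq_nonneg l), mul_nonneg (sub_nonneg.2 h3) (sq_nonneg l)]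
    refine mul_log_lt_log_of_pow_lt_pow (a := 11) (b := 4) (by norm_num) hl1 ?_ ?_
    · have : 1 / 4 ≤ (2 - l) * ((3 : ℕ) * (l + 1) - l) / (l * (l - 1)) := by
        rw [le_div_iff₀ hd]
        push_cast
        nlinarith
      push_cast at *
      linarith
    · calc l ^ 11 < 1.9 ^ 11 := by gcongr
        _ < _ := by norm_num
  · have hm' : (4 : ℝ) ≤ m := by exact_mod_cast hm
    refine mul_log_lt_log_of_pow_lt_pow (a := 3) (b := 1) (by norm_num) hl1 ?_ ?_
    · have : 0 ≤ (2 - l) * (m * (l + 1) - l) / (l * (l - 1)) :=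
        div_nonneg (mul_nonneg (by linarith) (by nlinarith)) hd.le
      push_cast
      linarith
    · calc l ^ 3 < 2 ^ 3 := by gcongr
        _ ≤ _ := by push_cast; linarith
end
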